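/- Let n ≥ 1, let ε_1, …, ε_n be the standard basis of ℝ^n, and take the Alfeld split AS(Δ_n) with vertices e_0 = 0, v = ε_1 + ⋯ + ε_n, and e_i = v + ε_i for i = 1, …, n. Identify ℝ^n with {x_{n+1} = 1} ⊂ ℝ^{n+1}. Then the collection of linear spans in ℝ^{n+1} of the cones over the interior codimension-one faces τ_{ij} = conv({v} ∪ {e_k : k ≠ i, j}), 0 ≤ i < j ≤ n, is exactly the braid arrangement: these spans are precisely the binom(n+1, 2) hyperplanes {x ∈ ℝ^{n+1} : x_a = x_b}, 1 ≤ a < b ≤ n+1. Specifically, for 1 ≤ i < j ≤ n the span of the cone over τ_{ij} is {x_i = x_j}, and for 1 ≤ j ≤ n the span of the cone over τ_{0j} is {x_j = x_{n+1}}. -/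

import Mathlib

noncomputable section

/-- The cone `{t·(p, 1) : t ≥ 0, p ∈ X} ⊆ ℝ^{n+1}` over a subset `X ⊆ ℝ^n`, where `ℝ^n` is
identified with the affine hyperplane `{x_{n+1} = 1}`. -/
def coneOver {n : ℕ} (X : Set (Fin n → ℝ)) : Set (Fin (n + 1) → ℝ) :=
  { y | ∃ t : ℝ, 0 ≤ t ∧ ∃ p ∈ X, y = t • (Fin.snoc p 1 : Fin (n + 1) → ℝ) }

/-- The interior split point `v = ε_1 + ⋯ + ε_n = (1, …, 1)` of the standard Alfeld split. -/
def alfeldVtx (n : ℕ) : Fin n → ℝ := fun _ => 1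

/-- The vertices of the standard Alfeld split: `e_0 = 0` and `e_i = v + ε_i` for
`i = 1, …, n`. -/
def alfeldPts (n : ℕ) : Fin (n + 1) → Fin n → ℝ :=
  Fin.cases (motive := fun _ => Fin n → ℝ) 0 (fun i => alfeldVtx n + Pi.single i 1)

/-- The interior codimension-one face `τ_{ij} = conv({v} ∪ {e_k : k ≠ i, j})` of the standard
Alfeld split. -/
def alfeldFacet (n : ℕ) (i j : Fin (n + 1)) : Set (Fin n → ℝ) :=
  convexHull ℝ ({alfeldVtx n} ∪ alfeldPts n '' {k | k ≠ i ∧ k ≠ j})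

/-- The point `(p, 1)` of `ℝ^{n+1}` above a point `p` of `ℝ^n`. -/
def homogenize {n : ℕ} (p : Fin n → ℝ) : Fin (n + 1) → ℝ := Fin.snoc p 1

/-- The linear span of the cone over a convex hull is spanned by the lifted generators. -/
theorem span_coneOver_convexHull {n : ℕ} (S : Set (Fin n → ℝ)) :
    Submodule.span ℝ (coneOver (convexHull ℝ S)) = Submodule.span ℝ (homogenize '' S) := by
  apply le_antisymm <;> rw [Submodule.span_le]
  · set W := Submodule.span ℝ (homogenize '' S)
    have hconv : Convex ℝ {p : Fin n → ℝ | homogenize p ∈ W} := by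
      intro p (hp : homogenize p ∈ W) q (hq : homogenize q ∈ W) a b _ _ hab
      change homogenize (a • p + b • q) ∈ W
      have h : homogenize (a • p + b • q) = a • homogenize p + b • homogenize q := by
        ext k
        refine Fin.lastCases ?_ (fun k => ?_) k <;> simp [homogenize, hab]
      rw [h]
      exact W.add_mem (W.smul_mem a hp) (W.smul_mem b hq)
    rintro _ ⟨t, -, p, hp, rfl⟩
    have hsub : S ⊆ {p : Fin n → ℝ | homogenize p ∈ W} :=
      fun q hq => Submodule.subset_span (Set.mem_image_of_mem _ hq)
    have hmem : homogenize p ∈ W := convexHull_min hsub hconv hp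
    exact W.smul_mem t hmem
  · rintro _ ⟨p, hp, rfl⟩
    exact Submodule.subset_span ⟨1, zero_le_one, p, subset_convexHull ℝ S hp, (one_smul ℝ _).symm⟩

/-- A submodule containing the all-ones vector and every coordinate vector other than the
`a`-th and `b`-th contains the hyperplane `{x_a = x_b}`. -/
theorem mem_of_ones_mem_of_single_mem {ι : Type*} [Fintype ι] [DecidableEq ι]
    {W : Submodule ℝ (ι → ℝ)} {a b : ι} (hone : (1 : ι → ℝ) ∈ W)
    (hsingle : ∀ k, k ≠ a → k ≠ b → (Pi.single k 1 : ι → ℝ) ∈ W)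
    {x : ι → ℝ} (hx : x a = x b) : x ∈ W := by
  have h : x - x a • (1 : ι → ℝ) ∈ W := by
    rw [pi_eq_sum_univ' (x - x a • (1 : ι → ℝ))]
    refine W.sum_mem fun k _ => ?_
    by_cases hk : k = a ∨ k = b
    · rcases hk with rfl | rfl <;> simp [hx]
    · push Not at hk
      convert W.smul_mem _ (hsingle k hk.1 hk.2) using 2
  simpa using W.add_mem h (W.smul_mem (x a) hone)

/-- The coordinate of `ℝ^{n+1}` attached to each vertex of the Alfeld split: the last one for
`e_0`, and the `i`-th one for `e_i`. -/
def alfeldCoord (n : ℕ) : Fin (n + 1) → Fin (n + 1) :=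
  Fin.cases (motive := fun _ => Fin (n + 1)) (Fin.last n) Fin.castSucc

@[simp] theorem alfeldCoord_zero (n : ℕ) : alfeldCoord n 0 = Fin.last n := rfl

@[simp] theorem alfeldCoord_succ {n : ℕ} (i : Fin n) : alfeldCoord n i.succ = i.castSucc := rfl

theorem alfeldCoord_surjective (n : ℕ) : Function.Surjective (alfeldCoord n) :=
  fun a => Fin.lastCases ⟨0, rfl⟩ (fun i => ⟨i.succ, rfl⟩) a

theorem alfeldCoord_injective (n : ℕ) : Function.Injective (alfeldCoord n) :=
  Finite.injective_iff_surjective.mpr (alfeldCoord_surjective n)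

theorem homogenize_alfeldVtx (n : ℕ) : homogenize (alfeldVtx n) = 1 := by
  ext k
  refine Fin.lastCases ?_ (fun k => ?_) k <;> simp [homogenize, alfeldVtx]

theorem homogenize_alfeldPts_zero (n : ℕ) :
    homogenize (alfeldPts n 0) = Pi.single (Fin.last n) 1 := by
  ext k
  refine Fin.lastCases ?_ (fun k => ?_) k <;> simp [homogenize, alfeldPts]

theorem homogenize_alfeldPts_succ {n : ℕ} (i : Fin n) :
    homogenize (alfeldPts n i.succ) = 1 + Pi.single i.castSucc 1 := by
  ext k
  refine Fin.lastCases ?_ (fun k => ?_) k <;>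
    simp [homogenize, alfeldPts, alfeldVtx, Pi.single_apply]

/-- Modulo the all-ones vector, the lifted vertices are the coordinate vectors. -/
theorem homogenize_alfeldPts_mem_iff {n : ℕ} {W : Submodule ℝ (Fin (n + 1) → ℝ)}
    (hone : (1 : Fin (n + 1) → ℝ) ∈ W) (k : Fin (n + 1)) :
    homogenize (alfeldPts n k) ∈ W ↔
      (Pi.single (alfeldCoord n k) 1 : Fin (n + 1) → ℝ) ∈ W := by
  refine Fin.cases ?_ (fun i => ?_) k
  · rw [homogenize_alfeldPts_zero, alfeldCoord_zero]
  · rw [homogenize_alfeldPts_succ, alfeldCoord_succ, W.add_mem_iff_right hone]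

/-- The linear span of the cone over an interior facet is a braid hyperplane. -/
theorem span_coneOver_alfeldFacet (n : ℕ) (i j : Fin (n + 1)) :
    (Submodule.span ℝ (coneOver (alfeldFacet n i j)) : Set (Fin (n + 1) → ℝ)) =
      {x | x (alfeldCoord n i) = x (alfeldCoord n j)} := by
  rw [alfeldFacet, span_coneOver_convexHull]
  apply Set.Subset.antisymm
  · let W : Submodule ℝ (Fin (n + 1) → ℝ) :=
      LinearMap.eqLocus (LinearMap.proj (alfeldCoord n i)) (LinearMap.proj (alfeldCoord n j))
    have hone : (1 : Fin (n + 1) → ℝ) ∈ W := rfl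
    change Submodule.span ℝ _ ≤ W
    rw [Submodule.span_le]
    rintro _ ⟨p, rfl | ⟨k, ⟨hki, hkj⟩, rfl⟩, rfl⟩
    · rw [homogenize_alfeldVtx]
      exact hone
    · refine (homogenize_alfeldPts_mem_iff hone k).mpr ?_
      simp [W, (alfeldCoord_injective n).ne hki.symm, (alfeldCoord_injective n).ne hkj.symm]
  · intro x hx
    set W := Submodule.span ℝ (homogenize ''
      ({alfeldVtx n} ∪ alfeldPts n '' {k | k ≠ i ∧ k ≠ j}))
    have hone : (1 : Fin (n + 1) → ℝ) ∈ W :=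
      Submodule.subset_span ⟨alfeldVtx n, Or.inl rfl, homogenize_alfeldVtx n⟩
    refine mem_of_ones_mem_of_single_mem hone (fun a hai haj => ?_) hx
    obtain ⟨k, rfl⟩ := alfeldCoord_surjective n a
    refine (homogenize_alfeldPts_mem_iff hone k).mp (Submodule.subset_span ⟨_, Or.inr ⟨k, ?_, rfl⟩, rfl⟩)
    exact ⟨fun h => hai (h ▸ rfl), fun h => haj (h ▸ rfl)⟩

/-- For the standard Alfeld split (vertices `e_0 = 0`, `v = (1,…,1)`, `e_i = v + ε_i`), the
linear spans in `ℝ^{n+1}` of the cones over the interior codimension-one faces `τ_{ij}` are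
exactly the hyperplanes of the braid arrangement: for `1 ≤ i < j ≤ n` the span of the cone
over `τ_{ij}` is `{x_i = x_j}`, for `1 ≤ j ≤ n` the span of the cone over `τ_{0j}` is
`{x_j = x_{n+1}}`, and the collection of all these spans is precisely the collection of the
`binom(n+1,2)` braid hyperplanes `{x_a = x_b}`, `1 ≤ a < b ≤ n+1`. -/
theorem alfeldFacet_spans_eq_braid (n : ℕ) (hn : 1 ≤ n) :
    (∀ i j : Fin n, i < j →
      (Submodule.span ℝ (coneOver (alfeldFacet n i.succ j.succ)) : Set (Fin (n + 1) → ℝ)) =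
        {x | x i.castSucc = x j.castSucc}) ∧
    (∀ j : Fin n,
      (Submodule.span ℝ (coneOver (alfeldFacet n 0 j.succ)) : Set (Fin (n + 1) → ℝ)) =
        {x | x j.castSucc = x (Fin.last n)}) ∧
    ({H : Set (Fin (n + 1) → ℝ) | ∃ i j : Fin (n + 1), i < j ∧
        H = (Submodule.span ℝ (coneOver (alfeldFacet n i j)) : Set (Fin (n + 1) → ℝ))} =
      {H : Set (Fin (n + 1) → ℝ) | ∃ a b : Fin (n + 1), a < b ∧ H = {x | x a = x b}}) := by
  refine ⟨fun i j _ => span_coneOver_alfeldFacet n i.succ j.succ, fun j => ?_, ?_⟩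
  · simpa [eq_comm] using span_coneOver_alfeldFacet n 0 j.succ
  · simp only [span_coneOver_alfeldFacet]
    have hsymm (a b : Fin (n + 1)) :
        {x : Fin (n + 1) → ℝ | x a = x b} = {x | x b = x a} :=
      Set.ext fun _ => eq_comm
    ext H
    constructor
    · rintro ⟨i, j, hij, rfl⟩
      rcases lt_or_gt_of_ne ((alfeldCoord_injective n).ne hij.ne) with h | h
      · exact ⟨_, _, h, rfl⟩
      · exact ⟨_, _, h, hsymm _ _⟩
    · rintro ⟨a, b, hab, rfl⟩
      obtain ⟨i, rfl⟩ := alfeldCoord_surjective n a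
      obtain ⟨j, rfl⟩ := alfeldCoord_surjective n b
      rcases lt_or_gt_of_ne (ne_of_apply_ne _ hab.ne) with h | h
      · exact ⟨_, _, h, rfl⟩
      · exact ⟨_, _, h, hsymm _ _⟩

end
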